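/- arXiv:1708.03558 — 2 statements merged into one kernel-verified Lean document; each statement's English description precedes it below -/
import Mathlib

section
/- There exists a constant C > 0 such that the following holds: for every integer σ ≥ 2 and every string s of length n ≥ 2 using at most σ distinct letters, the sizes Zov3 and Znon3 of the LZ3 and novLZ3 parsings of s satisfy Znon3 ≤ C · Zov3 · (1 + log₂(n / (Zov3 · log_σ Zov3))). -/
attribute [local instance] Classical.propDecidable

/-- `PermOv s i ℓ` : the substring of `s` of length `ℓ` starting at 0-indexed position `i`
has an occurrence starting at some earlier position `j < i` (possibly overlapping it). -/
def PermOv {α : Type*} (s : List α) (i ℓ : ℕ) : Prop :=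
  ∃ j < i, (s.drop j).take ℓ = (s.drop i).take ℓ

/-- `PermNov s i ℓ` : the substring of `s` of length `ℓ` starting at 0-indexed position `i`
has an occurrence starting at some position `j` with `j + ℓ ≤ i` (not overlapping it). -/
def PermNov {α : Type*} (s : List α) (i ℓ : ℕ) : Prop :=
  ∃ j, j + ℓ ≤ i ∧ (s.drop j).take ℓ = (s.drop i).take ℓ

/-- `PermOv3 s i ℓ` : the substring of `s` of length `ℓ - 1` starting at 0-indexed position `i`
(i.e. the phrase of length `ℓ` starting at `i` minus its last letter) has an occurrence
starting at some earlier position `j < i` (possibly overlapping). -/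
def PermOv3 {α : Type*} (s : List α) (i ℓ : ℕ) : Prop :=
  ∃ j < i, (s.drop j).take (ℓ - 1) = (s.drop i).take (ℓ - 1)

/-- `PermNov3 s i ℓ` : the substring of `s` of length `ℓ - 1` starting at 0-indexed position `i`
has an occurrence starting at some position `j` with `j + (ℓ - 1) ≤ i` (so this occurrence
ends before position `i`). -/
def PermNov3 {α : Type*} (s : List α) (i ℓ : ℕ) : Prop :=
  ∃ j, j + (ℓ - 1) ≤ i ∧ (s.drop j).take (ℓ - 1) = (s.drop i).take (ℓ - 1)

/-- Length of the greedy phrase starting at 0-indexed position `i`: the largest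
`ℓ ≤ |s| - i` permitted by `P`, or `1` (a single letter) if no length is permitted. -/
noncomputable def phraseLen {α : Type*} (P : List α → ℕ → ℕ → Prop) (s : List α) (i : ℕ) : ℕ :=
  max 1 (Nat.findGreatest (fun ℓ => P s i ℓ) (s.length - i))

/-- The list of phrases of the greedy parsing (w.r.t. the permission predicate `P`)
of the suffix of `s` starting at 0-indexed position `i`. -/
noncomputable def phrasesFrom {α : Type*} (P : List α → ℕ → ℕ → Prop) (s : List α) (i : ℕ) :
    List (List α) :=
  if _h : i < s.length then
    (s.drop i).take (phraseLen P s i) :: phrasesFrom P s (i + phraseLen P s i)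
  else []
  termination_by s.length - i
  decreasing_by
    have h1 : 1 ≤ phraseLen P s i := by unfold phraseLen; exact Nat.le_max_left _ _
    omega

/-- The LZ parsing of `s` (phrases may overlap their earlier occurrences). -/
noncomputable def lzPhrases {α : Type*} (s : List α) : List (List α) := phrasesFrom PermOv s 0
/-- The novLZ parsing of `s` (earlier occurrences may not overlap the phrases). -/
noncomputable def novlzPhrases {α : Type*} (s : List α) : List (List α) := phrasesFrom PermNov s 0
/-- The LZ3 parsing of `s`. -/
noncomputable def lz3Phrases {α : Type*} (s : List α) : List (List α) := phrasesFrom PermOv3 s 0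
/-- The novLZ3 parsing of `s`. -/
noncomputable def novlz3Phrases {α : Type*} (s : List α) : List (List α) := phrasesFrom PermNov3 s 0

/-- `Zov`: the size (number of phrases) of the LZ parsing of `s`. -/
noncomputable def zOv {α : Type*} (s : List α) : ℕ := (lzPhrases s).length
/-- `Znon`: the size of the novLZ parsing of `s`. -/
noncomputable def zNov {α : Type*} (s : List α) : ℕ := (novlzPhrases s).length
/-- `Zov₃`: the size of the LZ3 parsing of `s`. -/
noncomputable def zOv3 {α : Type*} (s : List α) : ℕ := (lz3Phrases s).length
/-- `Znon₃`: the size of the novLZ3 parsing of `s`. -/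
noncomputable def zNov3 {α : Type*} (s : List α) : ℕ := (novlz3Phrases s).length

/-- `ts` is an LZ-type parsing of `s`: a decomposition of `s` into nonempty strings such that
each `tᵢ` is a single letter or occurs in `s[1..|t₁⋯tᵢ|-1]`. -/
def IsLZTypeParsing {α : Type*} (s : List α) (ts : List (List α)) : Prop :=
  ts.flatten = s ∧ (∀ t ∈ ts, t ≠ []) ∧
    ∀ i (h : i < ts.length),
      ts[i].length = 1 ∨ ts[i] <:+: s.take ((ts.take (i + 1)).flatten.length - 1)

/-- `ts` is a novLZ-type parsing of `s`: a decomposition of `s` into nonempty strings such that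
each `tᵢ` is a single letter or occurs in `t₁⋯tᵢ₋₁`. -/
def IsNovLZTypeParsing {α : Type*} (s : List α) (ts : List (List α)) : Prop :=
  ts.flatten = s ∧ (∀ t ∈ ts, t ≠ []) ∧
    ∀ i (h : i < ts.length),
      ts[i].length = 1 ∨ ts[i] <:+: (ts.take i).flatten

/-- `ts` is an LZ3-type parsing of `s`: a decomposition of `s` into nonempty strings such that
each `tᵢ` minus its last letter occurs in `s[1..|t₁⋯tᵢ|-2]`. -/
def IsLZ3TypeParsing {α : Type*} (s : List α) (ts : List (List α)) : Prop :=
  ts.flatten = s ∧ (∀ t ∈ ts, t ≠ []) ∧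
    ∀ i (h : i < ts.length),
      ts[i].dropLast <:+: s.take ((ts.take (i + 1)).flatten.length - 2)

/-- `ts` is a novLZ3-type parsing of `s`: a decomposition of `s` into nonempty strings such that
each `tᵢ` minus its last letter occurs in `t₁⋯tᵢ₋₁`. -/
def IsNovLZ3TypeParsing {α : Type*} (s : List α) (ts : List (List α)) : Prop :=
  ts.flatten = s ∧ (∀ t ∈ ts, t ≠ []) ∧
    ∀ i (h : i < ts.length),
      ts[i].dropLast <:+: (ts.take i).flatten


open Finset

theorem sub_eq_iff {α : Type*} (s : List α) (i j l : ℕ) :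
    (s.drop j).take l = (s.drop i).take l ↔ ∀ k < l, s[j+k]? = s[i+k]? := by
  constructor
  · intro h k hk
    have := congrArg (fun t => t[k]?) h
    simpa [List.getElem?_take, hk] using this
  · intro h
    apply List.ext_getElem?
    intro k
    by_cases hk : k < l
    · simpa [List.getElem?_take, hk] using h k hk
    · simp [List.getElem?_take, hk]

noncomputable def nx {α : Type*} (P : List α → ℕ → ℕ → Prop) (s : List α) (i : ℕ) : ℕ :=
  i + phraseLen P s i

theorem phraseLen_pos {α : Type*} (P : List α → ℕ → ℕ → Prop) (s : List α) (i : ℕ) :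
    1 ≤ phraseLen P s i := by unfold phraseLen; exact Nat.le_max_left _ _

theorem phraseLen_le {α : Type*} (P : List α → ℕ → ℕ → Prop) (s : List α) (i : ℕ)
    (h : i < s.length) : phraseLen P s i ≤ s.length - i := by
  unfold phraseLen
  have := Nat.findGreatest_le (P := fun ℓ => P s i ℓ) (s.length - i)
  omega

theorem le_phraseLen {α : Type*} (P : List α → ℕ → ℕ → Prop) (s : List α) (i m : ℕ)
    (hm : m ≤ s.length - i) (h : P s i m) : m ≤ phraseLen P s i := by
  unfold phraseLen
  exact le_trans (Nat.le_findGreatest hm h) (Nat.le_max_right _ _)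

theorem phraseLen_spec {α : Type*} (P : List α → ℕ → ℕ → Prop) (s : List α) (i : ℕ) 
    (h : phraseLen P s i ≠ 1) : P s i (phraseLen P s i) := by
  unfold phraseLen at h ⊢
  have h2 : max 1 (Nat.findGreatest (fun ℓ => P s i ℓ) (s.length - i)) =
    Nat.findGreatest (fun ℓ => P s i ℓ) (s.length - i) := by omega
  rw [h2]
  refine Nat.findGreatest_of_ne_zero (P := fun ℓ => P s i ℓ) rfl ?_
  omega

theorem phrases_len {α : Type*} (P : List α → ℕ → ℕ → Prop) (s : List α) (m : ℕ) :
    ∀ i, s.length - i ≤ m → i ≤ s.length →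
    (∀ t < (phrasesFrom P s i).length, (nx P s)^[t] i < s.length) ∧
      (nx P s)^[(phrasesFrom P s i).length] i = s.length := by
  induction m with
  | zero =>
    intro i h1 h2
    rw [phrasesFrom, dif_neg (by omega)]
    simp; omega
  | succ m ih =>
    intro i h1 h2
    by_cases h : i < s.length
    · have p1 := phraseLen_pos P s i
      have p2 := phraseLen_le P s i h
      obtain ⟨q1, q2⟩ := ih (i + phraseLen P s i) (by omega) (by omega)
      rw [phrasesFrom, dif_pos h]
      constructor
      · intro t ht
        cases t with
        | zero => simpa using h
        | succ t =>
          rw [Function.iterate_succ_apply]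
          apply q1
          simpa using ht
      · rw [List.length_cons, Function.iterate_succ_apply]
        exact q2
    · rw [phrasesFrom, dif_neg h]
      simp; omega

/-- `a` enumerates the boundaries of the greedy parsing. -/
structure Parse {α : Type*} (P : List α → ℕ → ℕ → Prop) (s : List α) (a : ℕ → ℕ) (r : ℕ) : Prop where
  zero : a 0 = 0
  last : a r = s.length
  step : ∀ t, a (t+1) = a t + phraseLen P s (a t)
  lt : ∀ t < r, a t < s.length

theorem exists_parse {α : Type*} (P : List α → ℕ → ℕ → Prop) (s : List α) :
    ∃ a, Parse P s a (phrasesFrom P s 0).length := by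
  obtain ⟨h1, h2⟩ := phrases_len P s s.length 0 (by omega) (by omega)
  exact ⟨fun t => (nx P s)^[t] 0, by simp, h2, fun t => by
    simp only [Function.iterate_succ_apply', nx], h1⟩

theorem Parse.mono {α : Type*} {P : List α → ℕ → ℕ → Prop} {s : List α} {a : ℕ → ℕ} {r : ℕ}
    (h : Parse P s a r) : StrictMono a := by
  apply strictMono_nat_of_lt_succ
  intro t
  have := h.step t
  have := phraseLen_pos P s (a t)
  omega

theorem Parse.sum {α : Type*} {P : List α → ℕ → ℕ → Prop} {s : List α} {a : ℕ → ℕ} {r : ℕ}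
    (h : Parse P s a r) : ∑ t ∈ range r, (a (t+1) - a t) = s.length := by
  rw [Finset.sum_range_tsub h.mono.monotone, h.last, h.zero]; simp

theorem Parse.dist {α : Type*} {P : List α → ℕ → ℕ → Prop} {s : List α} {a : ℕ → ℕ} {r : ℕ}
    (h : Parse P s a r)
    (hP : ∀ i j l, 1 ≤ l → j + l ≤ i → (∀ k < l, s[j+k]? = s[i+k]?) → P s i (l+1))
    (t t' l : ℕ) (htt : t < t') (ht : t' + 1 < r) (h1 : a (t+1) - a t = l) (h2 : a (t'+1) - a t' = l) :
    ¬ ∀ k < l, s[a t + k]? = s[a t' + k]? := by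
  intro hk
  have m1 := h.mono (Nat.lt_succ_self t)
  have m2 := h.mono.monotone (show t+1 ≤ t' from htt)
  have m3 := h.lt _ ht
  have m4 := h.mono (Nat.lt_succ_self t')
  have m5 := h.step t'
  simp only [Nat.succ_eq_add_one] at *
  have := le_phraseLen P s (a t') (l+1) (by omega) (hP _ _ l (by omega) (by omega) hk)
  omega

theorem Parse.count_eq {α : Type*} {P : List α → ℕ → ℕ → Prop} {s : List α} {a : ℕ → ℕ} {r : ℕ}
    (h : Parse P s a r)
    (hP : ∀ i j l, 1 ≤ l → j + l ≤ i → (∀ k < l, s[j+k]? = s[i+k]?) → P s i (l+1))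
    (σ : ℕ) (hσ : s.toFinset.card ≤ σ) (l : ℕ) :
    ((range (r-1)).filter (fun t => a (t+1) - a t = l)).card ≤ σ ^ l := by
  have hmem : ∀ t ∈ (range (r-1)).filter (fun t => a (t+1) - a t = l), ∀ k : Fin l, 
      a t + k < s.length := by
    intro t ht k
    simp only [mem_filter, mem_range] at ht
    have := h.lt (t+1) (by omega)
    have := k.2
    omega
  let f : ℕ → (Fin l → Option α) := fun t k => s[a t + k]?
  have hinj : Set.InjOn f ((range (r-1)).filter (fun t => a (t+1) - a t = l)) := by
    intro t ht t' ht' hf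
    simp only [coe_filter, mem_range, Set.mem_ofPred_eq] at ht ht'
    have hf' : ∀ k < l, s[a t + k]? = s[a t' + k]? := fun k hk => congrFun hf ⟨k, hk⟩
    rcases lt_trichotomy t t' with h1 | h1 | h1
    · exact absurd hf' (h.dist hP t t' l h1 (by omega) ht.2 ht'.2)
    · exact h1
    · exact absurd (fun k hk => (hf' k hk).symm) (h.dist hP t' t l h1 (by omega) ht'.2 ht.2)
  have hmaps : ∀ t ∈ (range (r-1)).filter (fun t => a (t+1) - a t = l), 
      f t ∈ Fintype.piFinset (fun _ : Fin l => s.toFinset.image some) := by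
    intro t ht
    rw [Fintype.mem_piFinset]
    intro k
    have := hmem t ht k
    simp only [f, mem_image, List.mem_toFinset]
    exact ⟨s[a t + k], List.getElem_mem _, by simp⟩
  calc _ ≤ (Fintype.piFinset (fun _ : Fin l => s.toFinset.image some)).card := 
        Finset.card_le_card_of_injOn f hmaps hinj
    _ ≤ σ ^ l := by
        simp only [Fintype.card_piFinset, prod_const, card_univ, Fintype.card_fin]
        exact Nat.pow_le_pow_left (le_trans card_image_le hσ) _

theorem Parse.count_le {α : Type*} {P : List α → ℕ → ℕ → Prop} {s : List α} {a : ℕ → ℕ} {r : ℕ}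
    (h : Parse P s a r)
    (hP : ∀ i j l, 1 ≤ l → j + l ≤ i → (∀ k < l, s[j+k]? = s[i+k]?) → P s i (l+1))
    (σ : ℕ) (hσ : s.toFinset.card ≤ σ) (k : ℕ) :
    ((range (r-1)).filter (fun t => a (t+1) - a t ≤ k)).card ≤ ∑ j ∈ range k, σ ^ (j+1) := by
  induction k with
  | zero =>
    simp only [range_zero, sum_empty, nonpos_iff_eq_zero, card_eq_zero]
    apply Finset.filter_false_of_mem
    intro t _
    have := h.mono (Nat.lt_succ_self t)
    simp only [Nat.succ_eq_add_one] at *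
    omega
  | succ k ih =>
    rw [sum_range_succ]
    refine le_trans ?_ (Nat.add_le_add ih (h.count_eq hP σ hσ (k+1)))
    refine le_trans (card_le_card ?_) (card_union_le _ _)
    intro t
    simp only [mem_filter, mem_union, mem_range]
    omega

theorem sum_trunc (ι : Finset ℕ) (w : ℕ → ℕ) (k : ℕ) :
    k * ι.card ≤ ∑ t ∈ ι, w t + ∑ i ∈ range k, (ι.filter (fun t => w t ≤ i)).card := by
  have key : ∀ k, ∑ t ∈ ι, (k - w t) = ∑ i ∈ range k, (ι.filter (fun t => w t ≤ i)).card := by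
    intro k
    induction k with
    | zero => simp
    | succ k ih =>
      rw [sum_range_succ, ← ih, Finset.card_filter, ← sum_add_distrib]
      apply sum_congr rfl
      intro t _
      split_ifs <;> omega
  rw [← key, ← sum_add_distrib, mul_comm, ← smul_eq_mul, ← Finset.sum_const]
  apply sum_le_sum
  intro t _
  omega

/-- lower bound on the length -/
theorem Parse.lower {α : Type*} {P : List α → ℕ → ℕ → Prop} {s : List α} {a : ℕ → ℕ} {r : ℕ}
    (h : Parse P s a r)
    (hP : ∀ i j l, 1 ≤ l → j + l ≤ i → (∀ k < l, s[j+k]? = s[i+k]?) → P s i (l+1))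
    (σ : ℕ) (hσ : s.toFinset.card ≤ σ) (hr : 1 ≤ r) (k : ℕ) :
    1 + k * (r-1) ≤ s.length + ∑ i ∈ range k, ∑ j ∈ range i, σ ^ (j+1) := by
  have h1 := sum_trunc (range (r-1)) (fun t => a (t+1) - a t) k
  have h2 : ∑ i ∈ range k, ((range (r-1)).filter (fun t => a (t+1) - a t ≤ i)).card ≤
     ∑ i ∈ range k, ∑ j ∈ range i, σ ^ (j+1) := sum_le_sum fun i _ => h.count_le hP σ hσ i
  have h3 := h.sum
  obtain ⟨r, rfl⟩ : ∃ q, r = q + 1 := ⟨r-1, by omega⟩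
  rw [sum_range_succ] at h3
  have := h.mono (Nat.lt_succ_self r)
  simp only [Nat.succ_eq_add_one, card_range, Nat.add_sub_cancel] at *
  omega

/-- doubling -/
theorem double {α : Type*} (s : List α) (i x : ℕ) (hi : i < s.length)
    (hx : x < phraseLen PermOv3 s i) :
    min (i + phraseLen PermOv3 s i) (i + 2 * x + 1) ≤ i + x + phraseLen PermNov3 s (i+x) := by
  have hle := phraseLen_le PermOv3 s i hi
  have hp := phraseLen_pos PermNov3 s (i+x)
  by_cases h1 : phraseLen PermOv3 s i = 1
  · omega
  obtain ⟨j, hj, hs⟩ := phraseLen_spec PermOv3 s i h1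
  set ℓ := phraseLen PermOv3 s i
  rw [sub_eq_iff] at hs
  obtain ⟨d, rfl⟩ : ∃ d, i = j + d := ⟨i - j, by omega⟩
  have hper : ∀ c q, j ≤ q → q + c * d < j + d + (ℓ - 1) → s[q]? = s[q + c * d]? := by
    intro c
    induction c with
    | zero => intro q _ _; simp
    | succ c ih =>
      intro q hq hq2
      have e : q + (c+1) * d = q + c * d + d := by ring
      rw [e] at hq2 ⊢
      rw [ih q hq (by omega)]
      have := hs (q + c * d - j) (by omega)
      rw [show j + (q + c * d - j) = q + c * d by omega,
        show j + d + (q + c * d - j) = q + c * d + d by omega] at this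
      exact this
  have hd : 0 < d := by omega
  have hm := Nat.div_add_mod x d
  have hlt := Nat.mod_lt x hd
  have eD : (x / d + 1) * d = d * (x / d) + d := by ring
  have := le_phraseLen PermNov3 s (j+d+x) (min (ℓ - x) (x + 1)) (by omega) (by
    refine ⟨j + d + x - (x / d + 1) * d, by omega, ?_⟩
    rw [sub_eq_iff]
    intro k hk
    rw [hper (x/d+1) _ (by omega) (by omega)]
    congr 1
    omega)
  omega

theorem count_block (X : Finset ℕ) (L ℓ : ℕ) (hL : 1 ≤ L) (h0 : ∀ x ∈ X, x < ℓ)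
    (h1 : ∀ x ∈ X, ∀ y ∈ X, x < y → x + L ≤ y) (h2 : ∀ x ∈ X, ∀ y ∈ X, x < y → 2 * x ≤ y) :
    X.card ≤ 2 + Nat.log 2 (ℓ / L) := by
  let φ : ℕ → ℕ := fun x => if x < L then 0 else 1 + Nat.log 2 (x / L)
  have hφ : ∀ x ∈ X, ∀ y ∈ X, x < y → φ x < φ y := by
    intro x hx y hy hxy
    have a1 := h1 x hx y hy hxy
    have a2 := h2 x hx y hy hxy
    simp only [φ]
    rw [if_neg (show ¬ y < L by omega)]
    split_ifs with hxL
    · omega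
    · have p : 0 < x / L := Nat.div_pos (by omega) hL
      have : Nat.log 2 (x / L) + 1 ≤ Nat.log 2 (y / L) := by
        rw [← Nat.log_mul_base (by norm_num) (by omega)]
        apply Nat.log_mono_right
        rw [Nat.le_div_iff_mul_le hL]
        have := Nat.div_mul_le_self x L
        nlinarith
      omega
  have hinj : Set.InjOn φ X := by
    intro x hx y hy he
    rcases lt_trichotomy x y with h | h | h
    · have := hφ x hx y hy h; omega
    · exact h
    · have := hφ y hy x hx h; omega
  have := Finset.card_le_card_of_injOn (t := range (2 + Nat.log 2 (ℓ / L))) φ (by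
    intro x hx
    have := h0 x hx
    have l2 : Nat.log 2 (x / L) ≤ Nat.log 2 (ℓ / L) :=
      Nat.log_mono_right (Nat.div_le_div_right (by omega))
    simp only [φ, coe_range, Set.mem_Iio]
    split_ifs <;> omega) hinj
  simpa using this

theorem nov_count {α : Type*} (s : List α) (a b : ℕ → ℕ) (r N : ℕ)
    (ha : Parse PermOv3 s a r) (hb : Parse PermNov3 s b N) (L : ℕ) (hL : 1 ≤ L) :
    N ≤ 1 + ((range (N-1)).filter (fun t => b (t+1) - b t ≤ L - 1)).card +
      ∑ t ∈ range r, (2 + Nat.log 2 ((a (t+1) - a t) / L)) := by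
  have hcov : (range N) ⊆ ({N-1} ∪ (range (N-1)).filter (fun t => b (t+1) - b t ≤ L - 1)) ∪
      (range r).biUnion (fun t => (range N).filter 
        (fun u => L ≤ b (u+1) - b u ∧ a t ≤ b u ∧ b u < a (t+1))) := by
    intro u hu
    simp only [mem_union, mem_filter, mem_range, mem_singleton, mem_biUnion] at hu ⊢
    by_cases h1 : b (u+1) - b u ≤ L - 1
    · left; omega
    · right
      have hu2 := hb.lt u hu
      rw [← ha.last] at hu2
      have hex : ∃ t, b u < a t := ⟨r, hu2⟩
      have f1 := Nat.find_spec hex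
      have f2 := Nat.find_min' hex hu2
      have f0 : Nat.find hex ≠ 0 := by
        intro h0; rw [h0, ha.zero] at f1; omega
      obtain ⟨t, ht⟩ := Nat.exists_eq_succ_of_ne_zero f0
      have f3 := Nat.find_min hex (m := t) (by omega)
      rw [ht] at f1
      exact ⟨t, by omega, hu, by omega, by omega, f1⟩
  have hc := card_le_card hcov
  rw [card_range] at hc
  refine le_trans hc (le_trans (card_union_le _ _) (Nat.add_le_add ?_ ?_))
  · refine le_trans (card_union_le _ _) ?_
    simp
  · refine le_trans card_biUnion_le (sum_le_sum ?_)
    intro t ht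
    rw [mem_range] at ht
    have st := ha.step t
    set A := (range N).filter (fun u => L ≤ b (u+1) - b u ∧ a t ≤ b u ∧ b u < a (t+1)) with hA
    have hcard : (A.image (fun u => b u - a t)).card = A.card := by
      apply card_image_of_injOn
      intro u hu u' hu' he
      simp only [hA, coe_filter, mem_range, Set.mem_ofPred_eq] at hu hu' he
      exact hb.mono.injective (by omega)
    rw [← hcard]
    have key : ∀ u ∈ A, ∀ u' ∈ A, b u - a t < b u' - a t → 
        b u - a t + L ≤ b u' - a t ∧ 2 * (b u - a t) ≤ b u' - a t := by
      intro u hu u' hu' he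
      simp only [hA, mem_filter, mem_range] at hu hu'
      have : u < u' := hb.mono.lt_iff_lt.mp (by omega)
      have := hb.mono.monotone (show u + 1 ≤ u' from this)
      have sb := hb.step u
      have dd := double s (a t) (b u - a t) (ha.lt t ht) (by omega)
      rw [show a t + (b u - a t) = b u by omega] at dd
      omega
    apply count_block _ L _ hL
    · intro x hx
      obtain ⟨u, hu, rfl⟩ := mem_image.mp hx
      simp only [hA, mem_filter, mem_range] at hu
      omega
    · intro x hx y hy hxy
      obtain ⟨u, hu, rfl⟩ := mem_image.mp hx
      obtain ⟨u', hu', rfl⟩ := mem_image.mp hy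
      exact (key u hu u' hu' hxy).1
    · intro x hx y hy hxy
      obtain ⟨u, hu, rfl⟩ := mem_image.mp hx
      obtain ⟨u', hu', rfl⟩ := mem_image.mp hy
      exact (key u hu u' hu' hxy).2

theorem hP_ov {α : Type*} (s : List α) : 
    ∀ i j l, 1 ≤ l → j + l ≤ i → (∀ k < l, s[j+k]? = s[i+k]?) → PermOv3 s i (l+1) := by
  intro i j l hl hj hk
  exact ⟨j, by omega, by rw [sub_eq_iff]; simpa using hk⟩

theorem hP_nov {α : Type*} (s : List α) : 
    ∀ i j l, 1 ≤ l → j + l ≤ i → (∀ k < l, s[j+k]? = s[i+k]?) → PermNov3 s i (l+1) := by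
  intro i j l hl hj hk
  exact ⟨j, by omega, by rw [sub_eq_iff]; simpa using hk⟩

theorem two_le_zOv3 {α : Type*} (s : List α) (a : ℕ → ℕ) (r : ℕ)
    (ha : Parse PermOv3 s a r) (hs : 2 ≤ s.length) : 2 ≤ r := by
  have h1 : phraseLen PermOv3 s 0 = 1 := by
    by_contra h
    obtain ⟨j, hj, _⟩ := phraseLen_spec PermOv3 s 0 h
    omega
  have e0 := ha.zero
  have e1 := ha.step 0
  have e2 := ha.last
  rw [e0, h1] at e1
  by_contra h
  have : r = 0 ∨ r = 1 := by omega
  rcases this with rfl | rfl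
  · omega
  · simp only [zero_add] at e1
    omega

/-- geometric sums -/
noncomputable def gT (σ : ℕ) (k : ℕ) : ℝ := ∑ j ∈ range (k+1), (σ:ℝ)^j

noncomputable def gG (σ : ℕ) (k : ℕ) : ℝ := ∑ i ∈ range k, (gT σ i - 1)

theorem gT_closed (σ k : ℕ) : ((σ:ℝ) - 1) * gT σ k = (σ:ℝ)^(k+1) - 1 := by
  rw [gT, mul_comm]
  exact geom_sum_mul (σ:ℝ) (k+1)

theorem gT_zero (σ : ℕ) : gT σ 0 = 1 := by simp [gT]

theorem gT_succ (σ k : ℕ) : gT σ (k+1) = gT σ k + (σ:ℝ)^(k+1) := by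
  simp only [gT]; rw [sum_range_succ _ (k+1)]

theorem gG_succ (σ k : ℕ) : gG σ (k+1) = gG σ k + (gT σ k - 1) := by
  simp only [gG]; rw [sum_range_succ _ k]

theorem gT_ge (σ k : ℕ) (hσ : 2 ≤ σ) : (k:ℝ) + 1 ≤ gT σ k := by
  have h2 : (2:ℝ) ≤ σ := by exact_mod_cast hσ
  induction k with
  | zero => simp [gT_zero]
  | succ k ih =>
    rw [gT_succ]
    have : (1:ℝ) ≤ (σ:ℝ)^(k+1) := one_le_pow₀ (by linarith)
    push_cast; linarith

theorem gG_closed (σ k : ℕ) : ((σ:ℝ) - 1) * gG σ k = gT σ k - 1 - k * σ := by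
  induction k with
  | zero => simp [gG, gT_zero]
  | succ k ih =>
    have := gT_closed σ k
    rw [gG_succ, gT_succ, mul_add, ih]
    push_cast
    linear_combination this

theorem gG_eq (σ k : ℕ) :
    gG σ k = ((∑ i ∈ range k, ∑ j ∈ range i, σ ^ (j+1) : ℕ) : ℝ) := by
  push_cast
  rw [gG]
  apply sum_congr rfl
  intro i _
  rw [gT, sum_range_succ']
  simp

theorem endpoint (σ k : ℕ) (hσ : 2 ≤ σ) :
    (11/20 : ℝ) * (gT σ k * Real.log (gT σ k)) ≤ (1 + k * (gT σ k - 1) - gG σ k) * Real.log σ := by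
  have hT := gT_ge σ k hσ
  have hTc := gT_closed σ k
  have hGc := gG_closed σ k
  rcases Nat.eq_or_lt_of_le hσ with h | h
  · subst h
    have hl : 0 < Real.log 2 := Real.log_pos (by norm_num)
    push_cast at hTc hGc ⊢
    have hTe : gT 2 k = 2^(k+1) - 1 := by linarith
    by_cases hk : 3 ≤ k
    · have hk' : (3:ℝ) ≤ k := by exact_mod_cast hk
      have hlog : Real.log (gT 2 k) ≤ (k+1) * Real.log 2 := by
        have : Real.log (gT 2 k) ≤ Real.log ((2:ℝ)^(k+1)) :=
          Real.log_le_log (by linarith) (by linarith)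
        rw [Real.log_pow] at this
        push_cast at this
        exact this
      have : (11/20 : ℝ) * (gT 2 k * (k+1)) ≤ 1 + k * (gT 2 k - 1) - gG 2 k := by
        have hG : gG 2 k = gT 2 k - 1 - k * 2 := by linarith
        rw [hG]
        rcases Nat.eq_or_lt_of_le hk with h3 | h3
        · subst h3
          rw [hTe]; norm_num
        · have h4 : (4:ℝ) ≤ k := by exact_mod_cast h3
          nlinarith
      calc (11/20 : ℝ) * (gT 2 k * Real.log (gT 2 k))
          ≤ (11/20 : ℝ) * (gT 2 k * ((k+1) * Real.log 2)) := by
            have : 0 ≤ gT 2 k := by linarith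
            gcongr
        _ = ((11/20 : ℝ) * (gT 2 k * (k+1))) * Real.log 2 := by ring
        _ ≤ _ := by gcongr
    · have hG : gG 2 k = gT 2 k - 1 - k * 2 := by linarith
      have : k = 0 ∨ k = 1 ∨ k = 2 := by omega
      rcases this with rfl | rfl | rfl
      · rw [hG, hTe]; norm_num; exact hl.le
      · rw [hG, hTe]; norm_num
        have : Real.log ((3:ℝ)^5) ≤ Real.log ((2:ℝ)^9) := Real.log_le_log (by norm_num) (by norm_num)
        rw [Real.log_pow, Real.log_pow] at this
        push_cast at this
        linarith
      · rw [hG, hTe]; norm_num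
        have : Real.log ((7:ℝ)^7) ≤ Real.log ((2:ℝ)^20) := Real.log_le_log (by norm_num) (by norm_num)
        rw [Real.log_pow, Real.log_pow] at this
        push_cast at this
        linarith
  · have h3 : (3:ℝ) ≤ σ := by exact_mod_cast h
    have hl : 0 < Real.log σ := Real.log_pos (by linarith)
    have hTpos : 0 < gT σ k := by
      have : (0:ℝ) ≤ k := Nat.cast_nonneg k
      linarith
    have hp : (0:ℝ) < (σ:ℝ)^k := by positivity
    have hT1 : gT σ k ≤ 3/2 * (σ:ℝ)^k := by
      rw [pow_succ] at hTc
      nlinarith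
    have hlog : 2 * Real.log (gT σ k) ≤ (2*k+1) * Real.log σ := by
      have : Real.log ((gT σ k)^2) ≤ Real.log ((σ:ℝ)^(2*k+1)) := by
        apply Real.log_le_log (by positivity)
        calc (gT σ k)^2 ≤ (3/2 * (σ:ℝ)^k)^2 := by gcongr
          _ = 9/4 * (σ:ℝ)^(2*k) := by ring
          _ ≤ σ * (σ:ℝ)^(2*k) := by gcongr; linarith
          _ = _ := by ring
      rw [Real.log_pow, Real.log_pow] at this
      push_cast at this
      exact this
    have main : (11/20 : ℝ) * (gT σ k * (k+1/2)) ≤ 1 + k * (gT σ k - 1) - gG σ k ∨ k = 0 := by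
      have hk : k = 0 ∨ k = 1 ∨ 2 ≤ k := by omega
      rcases hk with rfl | rfl | hk
      · right; rfl
      · left
        simp [gG, gT, sum_range_succ]
        nlinarith
      · left
        have hk' : (2:ℝ) ≤ k := by exact_mod_cast hk
        have hG : gG σ k + k ≤ gT σ k / 2 := by
          by_contra hcon
          push Not at hcon
          have e : ((σ:ℝ) - 1) * (gG σ k + k) = gT σ k - 1 - k := by linear_combination hGc
          have : 2 * (gG σ k + k) ≤ ((σ:ℝ) - 1) * (gG σ k + k) :=
            mul_le_mul_of_nonneg_right (by linarith) (by linarith)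
          linarith
        nlinarith
    rcases main with main | rfl
    · calc (11/20 : ℝ) * (gT σ k * Real.log (gT σ k))
          ≤ (11/20 : ℝ) * (gT σ k * ((k+1/2) * Real.log σ)) := by
            gcongr; linarith
        _ = ((11/20 : ℝ) * (gT σ k * (k+1/2))) * Real.log σ := by ring
        _ ≤ _ := by gcongr
    · simp [gT_zero, gG]; exact hl.le

theorem n_lower (σ n z : ℕ) (hσ : 2 ≤ σ) (hz : 2 ≤ z)
    (h : ∀ k, 1 + k * (z-1) ≤ n + ∑ i ∈ range k, ∑ j ∈ range i, σ ^ (j+1)) :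
    (11/20 : ℝ) * (z * Real.log z) ≤ n * Real.log σ := by
  have hz2 : (2:ℝ) ≤ z := by exact_mod_cast hz
  have hσ2 : (2:ℝ) ≤ σ := by exact_mod_cast hσ
  have hl : 0 < Real.log σ := Real.log_pos (by linarith)
  have hf : ∀ k : ℕ, 1 + k * ((z:ℝ) - 1) - gG σ k ≤ n := by
    intro k
    have := h k
    rw [gG_eq]
    have h' : ((1 + k * (z-1) : ℕ) : ℝ) ≤ ((n + ∑ i ∈ range k, ∑ j ∈ range i, σ ^ (j+1) : ℕ) : ℝ) := by
      exact_mod_cast this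
    rw [Nat.cast_add, Nat.cast_add, Nat.cast_mul, Nat.cast_sub (by omega)] at h'
    push_cast at h' ⊢
    linarith
  have hex : ∃ k, (z:ℝ) ≤ gT σ k := ⟨z, by have := gT_ge σ z hσ; linarith⟩
  have f1 := Nat.find_spec hex
  have f0 : Nat.find hex ≠ 0 := by
    intro h0; rw [h0, gT_zero] at f1; linarith
  obtain ⟨k, hk⟩ := Nat.exists_eq_succ_of_ne_zero f0
  have f3 := Nat.find_min hex (m := k) (by omega)
  rw [hk] at f1
  push Not at f3
  simp only [Nat.succ_eq_add_one] at f1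
  have e1 := endpoint σ k hσ
  have e2 := endpoint σ (k+1) hσ
  have hfk := hf (k+1)
  have g1 := gT_ge σ k hσ
  have hkn : (0:ℝ) ≤ k := Nat.cast_nonneg k
  rw [gG_succ] at e2 hfk
  push_cast at e2 hfk
  set A := gT σ k
  set B := gT σ (k+1)
  have hAB : 0 < B - A := by linarith
  set θ := ((z:ℝ) - A) / (B - A) with hθ
  have t0 : 0 ≤ θ := div_nonneg (by linarith) hAB.le
  have t1 : 0 ≤ 1 - θ := by
    have : θ ≤ 1 := (div_le_one hAB).mpr (by linarith)
    linarith
  have hzc : (1 - θ) * A + θ * B = z := by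
    have : θ * (B - A) = z - A := div_mul_cancel₀ _ hAB.ne'
    linarith
  have hc := Real.convexOn_mul_log.2 (x := A) (y := B) (by simp; linarith) (by simp; linarith) t1 t0
    (by ring)
  simp only [smul_eq_mul] at hc
  rw [hzc] at hc
  have m1 := mul_le_mul_of_nonneg_left e1 t1
  have m2 := mul_le_mul_of_nonneg_left e2 t0
  have m3 := mul_le_mul_of_nonneg_right hfk hl.le
  have e3 : (1 - θ) * ((1 + k * (A - 1) - gG σ k) * Real.log σ) +
      θ * ((1 + (k + 1) * (B - 1) - (gG σ k + (A - 1))) * Real.log σ) =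
      (1 + (k+1) * ((z:ℝ) - 1) - (gG σ k + (A - 1))) * Real.log σ := by
    rw [← hzc]; ring
  linarith

theorem sum_pow_le (σ m : ℕ) (hσ : 2 ≤ σ) : ∑ j ∈ range m, σ^(j+1) ≤ σ^(m+1) := by
  induction m with
  | zero => simp
  | succ m ih =>
    rw [sum_range_succ, pow_succ σ (m+1)]
    have : σ^(m+1) * 2 ≤ σ^(m+1) * σ := Nat.mul_le_mul_left _ hσ
    omega

theorem natlog_le (ℓ L : ℕ) (hL : 1 ≤ L) :
    (Nat.log 2 (ℓ / L) : ℝ) ≤ Real.logb 2 (1 + (ℓ:ℝ) / L) := by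
  have hpos : 0 ≤ (ℓ:ℝ) / L := by positivity
  rcases Nat.eq_zero_or_pos (ℓ / L) with h | h
  · rw [h]; simp
    exact Real.logb_nonneg (by norm_num) (by linarith)
  · refine le_trans (Real.natLog_le_logb (ℓ / L) 2) ?_
    push_cast
    apply Real.logb_le_logb_of_le (by norm_num)
    · exact_mod_cast h
    · have := @Nat.cast_div_le ℝ _ _ _ ℓ L
      linarith

theorem jensen (z n L : ℕ) (hz : 1 ≤ z) (w : ℕ → ℕ) (hw : ∑ t ∈ range z, w t = n) :
    ∑ t ∈ range z, Real.logb 2 (1 + (w t : ℝ) / L) ≤ z * Real.logb 2 (1 + (n:ℝ) / (z * L)) := by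
  set y0 : ℝ := 1 + (n:ℝ) / (z * L) with hy
  have y0pos : 0 < y0 := by positivity
  have hl : 0 < Real.log 2 := Real.log_pos (by norm_num)
  have hzz : (z:ℝ) ≠ 0 := by positivity
  have key : ∀ t ∈ range z, Real.log (1 + (w t : ℝ) / L) ≤
      Real.log y0 + ((1 + (w t : ℝ) / L) / y0 - 1) := by
    intro t _
    have hp : 0 < 1 + (w t : ℝ) / L := by positivity
    have := Real.log_le_sub_one_of_pos (div_pos hp y0pos)
    rw [Real.log_div hp.ne' y0pos.ne'] at this
    linarith
  have hs := sum_le_sum key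
  have e : ∑ t ∈ range z, (Real.log y0 + ((1 + (w t : ℝ) / L) / y0 - 1)) = z * Real.log y0 := by
    rw [sum_add_distrib, sum_sub_distrib, ← sum_div, sum_add_distrib, ← sum_div, ← Nat.cast_sum, hw]
    simp only [sum_const, card_range, nsmul_eq_mul, mul_one]
    have : (z:ℝ) + n / L = z * y0 := by
      rw [hy, mul_add, mul_one]
      congr 1
      field_simp
    rw [this]
    field_simp
    ring
  rw [e] at hs
  simp only [Real.logb]
  rw [← sum_div, ← mul_div_assoc]
  gcongr

theorem final_arith (z n L σ N S : ℕ) (hσ : 2 ≤ σ) (hz : 2 ≤ z) (hL : L = max 1 (Nat.log σ z))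
    (w : ℕ → ℕ) (hw : ∑ t ∈ range z, w t = n)
    (hlow : (11/20 : ℝ) * (z * Real.log z) ≤ n * Real.log σ)
    (hS : S ≤ ∑ j ∈ range (L-1), σ^(j+1))
    (hN : N ≤ 1 + S + ∑ t ∈ range z, (2 + Nat.log 2 (w t / L))) :
    (N:ℝ) ≤ 100 * z * (1 + Real.logb 2 ((n:ℝ) / (z * Real.logb σ z))) := by
  have hz2 : (2:ℝ) ≤ z := by exact_mod_cast hz
  have hσ2 : (2:ℝ) ≤ σ := by exact_mod_cast hσ
  have hlσ : 0 < Real.log σ := Real.log_pos (by linarith)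
  have hlz : 0 < Real.log z := Real.log_pos (by linarith)
  have hL1 : 1 ≤ L := by omega
  have hL1' : (1:ℝ) ≤ L := by exact_mod_cast hL1
  have hSz : S ≤ z := by
    by_cases h1 : L = 1
    · rw [h1] at hS; simp at hS; omega
    · refine le_trans hS (le_trans (sum_pow_le σ (L-1) hσ) ?_)
      rw [show L - 1 + 1 = Nat.log σ z by omega]
      exact Nat.pow_log_le_self σ (by omega)
  set X := Real.logb σ z with hX
  have hXpos : 0 < X := Real.logb_pos (by linarith) (by linarith)
  have hXL : X ≤ 2 * L := by
    have h1 : X ≤ Nat.log σ z + 1 := by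
      rw [hX, Real.logb_le_iff_le_rpow (by linarith) (by linarith)]
      have := (Nat.lt_pow_succ_log_self (b := σ) (by omega) z).le
      exact_mod_cast this
    have h2 : ((Nat.log σ z + 1 : ℕ) : ℝ) ≤ ((2 * L : ℕ) : ℝ) := by
      exact_mod_cast (by omega : Nat.log σ z + 1 ≤ 2 * L)
    push_cast at h2
    linarith
  set R := (n:ℝ) / (z * X) with hR
  have hRl : 11/20 ≤ R := by
    rw [hR, le_div_iff₀ (by positivity)]
    have : X * Real.log σ = Real.log z := by
      rw [hX, Real.logb, div_mul_cancel₀ _ hlσ.ne']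
    have h3 : (11/20 * (z * X)) * Real.log σ ≤ n * Real.log σ := by
      calc _ = (11/20 : ℝ) * (z * (X * Real.log σ)) := by ring
        _ ≤ _ := by rw [this]; exact hlow
    exact le_of_mul_le_mul_right h3 hlσ
  have hb : 1 + (n:ℝ) / (z * L) ≤ 4 * R := by
    have : (n:ℝ) / (z * L) ≤ 2 * R := by
      rw [hR, div_le_iff₀ (by positivity)]
      have e : 2 * ((n:ℝ) / (z * X)) * (z * L) = n * (2 * L / X) := by
        field_simp
      rw [e]
      have : 1 ≤ 2 * L / X := by rw [le_div_iff₀ hXpos]; linarith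
      have hn : (0:ℝ) ≤ n := Nat.cast_nonneg n
      nlinarith
    linarith
  have hlog : Real.logb 2 (1 + (n:ℝ) / (z * L)) ≤ 2 + Real.logb 2 R := by
    have : Real.logb 2 (1 + (n:ℝ) / (z * L)) ≤ Real.logb 2 (4 * R) :=
      Real.logb_le_logb_of_le (by norm_num) (by positivity) hb
    rw [Real.logb_mul (by norm_num) (by linarith)] at this
    have h4 : Real.logb 2 4 = 2 := by
      rw [Real.logb_eq_iff_rpow_eq (by norm_num) (by norm_num) (by norm_num)]; norm_num
    linarith
  have hpos : 1/10 ≤ 1 + Real.logb 2 R := by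
    have h5 : Real.logb 2 (11/20) ≤ Real.logb 2 R :=
      Real.logb_le_logb_of_le (by norm_num) (by norm_num) hRl
    have h6 : -(9/10 : ℝ) ≤ Real.logb 2 (11/20) := by
      have h7 : Real.logb 2 (((2:ℝ)^9)⁻¹) ≤ Real.logb 2 ((11/20:ℝ)^10) :=
        Real.logb_le_logb_of_le (by norm_num) (by positivity) (by norm_num)
      rw [Real.logb_inv, Real.logb_pow, Real.logb_pow, Real.logb_self_eq_one (by norm_num)] at h7
      push_cast at h7
      linarith
    linarith
  have hsum : (N:ℝ) ≤ 1 + z + (2 * z + z * (2 + Real.logb 2 R)) := by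
    have h8 : (N:ℝ) ≤ 1 + S + ∑ t ∈ range z, (2 + (Nat.log 2 (w t / L) : ℝ)) := by
      exact_mod_cast hN
    have h9 : ∑ t ∈ range z, (2 + (Nat.log 2 (w t / L) : ℝ)) ≤ 
        ∑ t ∈ range z, (2 + Real.logb 2 (1 + (w t : ℝ) / L)) :=
      sum_le_sum fun t _ => by have := natlog_le (w t) L hL1; linarith
    rw [sum_add_distrib (f := fun _ => (2:ℝ)) (g := fun t => Real.logb 2 (1 + (w t : ℝ) / L))] at h9
    have h10 := jensen z n L (by omega) w hw
    have h11 : (S:ℝ) ≤ z := by exact_mod_cast hSz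
    have h12 : (z:ℝ) * Real.logb 2 (1 + (n:ℝ) / (z * L)) ≤ z * (2 + Real.logb 2 R) := by gcongr
    simp only [sum_const, card_range, nsmul_eq_mul] at h9
    linarith
  nlinarith

/-- There is a constant `C > 0` such that for every integer `σ ≥ 2` and every string `s`
of length `n ≥ 2` using at most `σ` distinct letters, the sizes `Zov₃` and `Znon₃` of the LZ3
and novLZ3 parsings of `s` satisfy `Znon₃ ≤ C · Zov₃ · (1 + log₂(n / (Zov₃ · log_σ Zov₃)))`. -/
theorem zNov3_le_zOv3_mul_log :
    ∃ C : ℝ, 0 < C ∧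
      ∀ (σ : ℕ), 2 ≤ σ →
        ∀ {α : Type*} (s : List α), 2 ≤ s.length → s.toFinset.card ≤ σ →
          (zNov3 s : ℝ) ≤ C * (zOv3 s : ℝ) *
            (1 + Real.logb 2 ((s.length : ℝ) /
              ((zOv3 s : ℝ) * Real.logb (σ : ℝ) (zOv3 s : ℝ)))) := by
  refine ⟨100, by norm_num, ?_⟩
  intro σ hσ α s hs hc
  obtain ⟨a, ha⟩ := exists_parse PermOv3 s
  obtain ⟨b, hb⟩ := exists_parse PermNov3 s
  have hz := two_le_zOv3 s a _ ha hs
  have hlow := n_lower σ s.length _ hσ hz (ha.lower (hP_ov s) σ hc (by omega))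
  exact final_arith _ s.length _ σ _ _ hσ hz rfl _ ha.sum hlow
    (hb.count_le (hP_nov s) σ hc _) (nov_count s a b _ _ ha hb _ (by omega))
end

section
/- There exist constants c₁, c₂, c₃ > 0 such that for all integers n > 1, σ with 2 ≤ σ ≤ n, and z with σ ≤ z ≤ n/log_σ n, there is a string s of length n over an alphabet of size σ whose LZ3 parsing size Zov3 satisfies c₁·z ≤ Zov3 ≤ c₂·z and whose novLZ3 parsing size Znon3 satisfies Znon3 ≥ c₃ · z · log₂(n / (z · log_σ z)). -/
attribute [local instance] Classical.propDecidable

namespace LZAux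

variable {α : Type*}

lemma len_pos (Q : List α → ℕ → ℕ → Prop) (s : List α) (i : ℕ) : 1 ≤ phraseLen Q s i := by
  unfold phraseLen; exact Nat.le_max_left _ _

lemma len_le (Q : List α → ℕ → ℕ → Prop) (s : List α) (i : ℕ) (h : i < s.length) :
    i + phraseLen Q s i ≤ s.length := by
  unfold phraseLen
  have := Nat.findGreatest_le (P := fun ℓ => Q s i ℓ) (s.length - i)
  omega

lemma le_len (Q : List α → ℕ → ℕ → Prop) (s : List α) (i l : ℕ) (h : l ≤ s.length - i)
    (hQ : Q s i l) : l ≤ phraseLen Q s i := by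
  unfold phraseLen
  exact le_trans (Nat.le_findGreatest (P := fun ℓ => Q s i ℓ) h hQ) (Nat.le_max_right _ _)

lemma len_spec (Q : List α → ℕ → ℕ → Prop) (s : List α) (i : ℕ) (h : 2 ≤ phraseLen Q s i) :
    Q s i (phraseLen Q s i) := by
  have h2 : phraseLen Q s i = Nat.findGreatest (fun ℓ => Q s i ℓ) (s.length - i) := by
    unfold phraseLen at *
    omega
  have h3 := Nat.findGreatest_of_ne_zero (P := fun ℓ => Q s i ℓ) h2.symm (by omega)
  exact h3

lemma count_le (Q : List α → ℕ → ℕ → Prop) (s : List α) (Φ : ℕ → ℕ)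
    (h : ∀ p < s.length, Φ p + 1 ≤ Φ (p + phraseLen Q s p)) :
    ∀ d i, i + d = s.length → Φ i + (phrasesFrom Q s i).length ≤ Φ s.length := by
  intro d
  induction d using Nat.strong_induction_on with
  | _ d ih =>
    intro i hi
    rw [phrasesFrom]
    split_ifs with hlt
    · have h1 := len_pos Q s i
      have h2 := len_le Q s i hlt
      have h3 := h i hlt
      have h4 := ih (d - phraseLen Q s i) (by omega) (i + phraseLen Q s i) (by omega)
      simp only [List.length_cons]
      omega
    · have : i = s.length := by omega
      subst this
      simp

lemma le_count (Q : List α → ℕ → ℕ → Prop) (s : List α) (Φ : ℕ → ℝ) (c : ℝ)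
    (h : ∀ p < s.length, Φ (p + phraseLen Q s p) ≤ Φ p + c) :
    ∀ d i, i + d = s.length → Φ s.length ≤ Φ i + c * (phrasesFrom Q s i).length := by
  intro d
  induction d using Nat.strong_induction_on with
  | _ d ih =>
    intro i hi
    rw [phrasesFrom]
    split_ifs with hlt
    · have h1 := len_pos Q s i
      have h2 := len_le Q s i hlt
      have h3 := h i hlt
      have h4 := ih (d - phraseLen Q s i) (by omega) (i + phraseLen Q s i) (by omega)
      simp only [List.length_cons]
      push_cast
      linarith
    · have : i = s.length := by omega
      subst this
      simp

lemma count_pos (Q : List α → ℕ → ℕ → Prop) (s : List α) (h : 0 < s.length) :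
    1 ≤ (phrasesFrom Q s 0).length := by
  rw [phrasesFrom, dif_pos h]
  simp

lemma sub_eq_iff (f : ℕ → α) (n i j l : ℕ) (hj : j ≤ i) (hi : i + l ≤ n) :
    ((((List.range n).map f).drop j).take l = (((List.range n).map f).drop i).take l) ↔
      ∀ x < l, f (j + x) = f (i + x) := by
  constructor
  · intro h x hx
    have h1 := congrArg (fun u => u[x]?) h
    simp only [List.getElem?_take, hx, if_true, List.getElem?_drop, List.getElem?_map] at h1
    rw [List.getElem?_range (by omega), List.getElem?_range (by omega)] at h1
    simpa using h1
  · intro h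
    apply List.ext_getElem?
    intro x
    by_cases hx : x < l
    · simp only [List.getElem?_take, hx, if_true, List.getElem?_drop, List.getElem?_map]
      rw [List.getElem?_range (by omega), List.getElem?_range (by omega)]
      simpa using h x hx
    · simp [List.getElem?_take, hx]

lemma ov_reach (f : ℕ → α) (n p q j : ℕ) (hpq : p < q) (hq : q ≤ n) (hj : j < p)
    (h : ∀ x, p + x + 1 < q → f (j + x) = f (p + x)) :
    q ≤ p + phraseLen PermOv3 ((List.range n).map f) p := by
  have := le_len PermOv3 ((List.range n).map f) p (q - p) (by simp; omega)
    ⟨j, hj, (sub_eq_iff f n p j _ hj.le (by omega)).2 (fun x hx => h x (by omega))⟩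
  omega

lemma ov_spec (f : ℕ → α) (n p : ℕ) (hp : p < n)
    (h : 2 ≤ phraseLen PermOv3 ((List.range n).map f) p) :
    ∃ j < p, ∀ x, x + 1 < phraseLen PermOv3 ((List.range n).map f) p → f (j + x) = f (p + x) := by
  obtain ⟨j, hj, h1⟩ := len_spec _ _ _ h
  have h2 := len_le PermOv3 ((List.range n).map f) p (by simpa using hp)
  simp only [List.length_map, List.length_range] at h2
  exact ⟨j, hj, fun x hx => (sub_eq_iff f n p j _ hj.le (by omega)).1 h1 x (by omega)⟩

lemma nov_spec (f : ℕ → α) (n p : ℕ) (hp : p < n)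
    (h : 2 ≤ phraseLen PermNov3 ((List.range n).map f) p) :
    ∃ j, j + phraseLen PermNov3 ((List.range n).map f) p ≤ p + 1 ∧
      ∀ x, x + 1 < phraseLen PermNov3 ((List.range n).map f) p → f (j + x) = f (p + x) := by
  obtain ⟨j, hj, h1⟩ := len_spec _ _ _ h
  have h2 := len_le PermNov3 ((List.range n).map f) p (by simpa using hp)
  simp only [List.length_map, List.length_range] at h2
  exact ⟨j, by omega, fun x hx => (sub_eq_iff f n p j _ (by omega) (by omega)).1 h1 x (by omega)⟩

/-- Letter number `r` of the `k`-th word. -/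
def letter (σ t k r : ℕ) : ℕ :=
  if r < 2 then 0 else if r % 2 = 0 then 1 else k / σ ^ (t - 1 - (r - 3) / 2) % σ

lemma letter_lt (σ t k r : ℕ) (hσ : 2 ≤ σ) : letter σ t k r < σ := by
  unfold letter
  split_ifs
  · omega
  · omega
  · exact Nat.mod_lt _ (by omega)

lemma mod_pow_eq (σ a b t : ℕ) (h : ∀ l < t, a / σ ^ l % σ = b / σ ^ l % σ) :
    a % σ ^ t = b % σ ^ t := by
  induction t with
  | zero => simp [Nat.mod_one]
  | succ t ih =>
    rw [Nat.mod_pow_succ, Nat.mod_pow_succ, ih (fun l hl => h l (by omega)), h t (by omega)]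

lemma letter_inj (σ t a b : ℕ) (ha : a < σ ^ t) (hb : b < σ ^ t)
    (h : ∀ r < 2 * t + 3, letter σ t a r = letter σ t b r) : a = b := by
  have := mod_pow_eq σ a b t (fun l hl => by
    have h1 := h (3 + 2 * (t - 1 - l)) (by omega)
    unfold letter at h1
    rw [if_neg (by omega), if_neg (by omega), if_neg (by omega), if_neg (by omega)] at h1
    have : t - 1 - (3 + 2 * (t - 1 - l) - 3) / 2 = l := by omega
    rwa [this] at h1)
  rwa [Nat.mod_eq_of_lt ha, Nat.mod_eq_of_lt hb] at this

lemma exists_cut (σ t k : ℕ) (hσ : 2 ≤ σ) (hk : 1 ≤ k) (hkt : k < σ ^ t) :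
    ∃ y, y < 2 * t + 3 ∧ (∀ o, o + 1 < y → letter σ t (k - 1) o = letter σ t k o) ∧
      (∀ o, y ≤ o → o < 2 * t + 3 → letter σ t k o = letter σ t 0 o) := by
  have hex : ∃ v, ¬ σ ^ (v + 1) ∣ k :=
    ⟨k, fun hd => by
      have h1 := Nat.le_of_dvd (by omega) hd
      have h2 : k + 1 < σ ^ (k + 1) := Nat.lt_pow_self (by omega)
      omega⟩
  classical
  obtain ⟨v, hv, hmin⟩ : ∃ v, ¬ σ ^ (v + 1) ∣ k ∧ ∀ u < v, σ ^ (u + 1) ∣ k :=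
    ⟨Nat.find hex, Nat.find_spec hex, fun u hu => not_not.1 (Nat.find_min hex hu)⟩
  have hdv : σ ^ v ∣ k := by
    rcases v with _ | v
    · simp
    · exact hmin v (by omega)
  have hvt : v < t := by
    have h1 := Nat.le_of_dvd (by omega) hdv
    exact (Nat.pow_lt_pow_iff_right (by omega : 1 < σ)).1 (lt_of_le_of_lt h1 hkt)
  refine ⟨2 * (t - v) + 2, by omega, ?_, ?_⟩
  · intro o ho
    unfold letter
    split_ifs with h1 h2
    · rfl
    · rfl
    · congr 1
      have hl : v + 1 ≤ t - 1 - (o - 3) / 2 := by omega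
      have hnd : ¬ σ ^ (t - 1 - (o - 3) / 2) ∣ k := fun hd =>
        hv ((pow_dvd_pow σ hl).trans hd)
      obtain ⟨k', rfl⟩ : ∃ k', k = k' + 1 := ⟨k - 1, by omega⟩
      rw [Nat.succ_div, if_neg hnd]
      simp
  · intro o h1 h2
    unfold letter
    split_ifs with h3 h4
    · rfl
    · rfl
    · have hl : t - 1 - (o - 3) / 2 + 1 ≤ v := by omega
      have hd : σ ^ (t - 1 - (o - 3) / 2 + 1) ∣ k := (pow_dvd_pow σ hl).trans hdv
      obtain ⟨c, rfl⟩ := hd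
      rw [pow_succ, mul_assoc, Nat.mul_div_cancel_left _ (by positivity)]
      simp

/-- The infinite sequence. -/
def seq (σ t L : ℕ) (p : ℕ) : ℕ := letter σ t (p / L) (p % (2 * t + 3))

lemma seq_at (σ t e k o : ℕ) (ho : o < e * (2 * t + 3)) :
    seq σ t (e * (2 * t + 3)) (k * (e * (2 * t + 3)) + o) = letter σ t k (o % (2 * t + 3)) := by
  unfold seq
  congr 1
  · rw [mul_comm k, Nat.mul_add_div (by omega), Nat.div_eq_of_lt ho, add_zero]
  · rw [← mul_assoc, add_comm, Nat.add_mul_mod_self_right]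

lemma aligned_block (P e j : ℕ) (hP : 0 < P) (he : 0 < e) (h : j % P = 0) (x : ℕ) (hx : x < P) :
    (j + x) / (e * P) = j / (e * P) := by
  rw [mul_comm, ← Nat.div_div_eq_div_mul, ← Nat.div_div_eq_div_mul]
  congr 1
  obtain ⟨c, rfl⟩ := Nat.dvd_of_mod_eq_zero h
  rw [Nat.mul_add_div hP, Nat.div_eq_of_lt hx]
  simp [hP]

/-- A word does not occur before its block. -/
lemma word_new (σ t e a j : ℕ) (ht : 1 ≤ t) (he : 0 < e) (ha : a % (2 * t + 3) = 0)
    (hk : a / (e * (2 * t + 3)) < σ ^ t)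
    (h : ∀ x < 2 * t + 3, seq σ t (e * (2 * t + 3)) (j + x) = seq σ t (e * (2 * t + 3)) (a + x)) :
    a / (e * (2 * t + 3)) * (e * (2 * t + 3)) ≤ j := by
  set P := 2 * t + 3 with hPdef
  have hP : 0 < P := by omega
  have hax : ∀ x < P, (a + x) % P = x := by
    intro x hx
    rw [Nat.add_mod, ha, zero_add, Nat.mod_mod, Nat.mod_eq_of_lt hx]
  have hj : j % P = 0 := by
    have h0 := h 0 (by omega)
    have h1 := h 1 (by omega)
    unfold seq at h0 h1
    rw [← hPdef] at h0 h1
    rw [hax 0 (by omega)] at h0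
    rw [hax 1 (by omega)] at h1
    have hr := Nat.mod_lt j hP
    by_contra hne
    have h2 : (j + 1) % P = if j % P + 1 = P then 0 else j % P + 1 := by
      rw [Nat.add_mod, Nat.mod_eq_of_lt (show 1 < P by omega)]
      split_ifs with hh
      · rw [hh, Nat.mod_self]
      · exact Nat.mod_eq_of_lt (by omega)
    rw [add_zero] at h0
    rw [h2] at h1
    generalize j % P = r at *
    by_cases hev : r % 2 = 0
    · unfold letter at h0
      rw [if_neg (by omega), if_pos hev] at h0
      simp at h0
    · rw [if_neg (by omega)] at h1
      unfold letter at h1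
      rw [if_neg (by omega), if_pos (by omega)] at h1
      simp at h1
  by_contra hlt
  push Not at hlt
  have hL : 0 < e * P := by positivity
  have hjk : j / (e * P) < a / (e * P) := by
    rw [Nat.div_lt_iff_lt_mul hL]; exact hlt
  have := letter_inj σ t (j / (e * P)) (a / (e * P)) (by omega) hk (by
    intro r hr
    have h1 := h r hr
    unfold seq at h1
    rw [← hPdef, aligned_block P e j hP he hj r hr, aligned_block P e a hP he ha r hr,
      hax r hr, Nat.add_mod, hj, zero_add, Nat.mod_mod, Nat.mod_eq_of_lt hr] at h1
    exact h1)
  omega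

lemma ov_upper (f : ℕ → α) (σ t e n : ℕ) (hσ : 2 ≤ σ) (ht : 1 ≤ t) (he : 2 ≤ e)
    (hf : ∀ a b, f a = f b ↔ seq σ t (e * (2 * t + 3)) a = seq σ t (e * (2 * t + 3)) b)
    (hn : n / (e * (2 * t + 3)) < σ ^ t) :
    (phrasesFrom PermOv3 ((List.range n).map f) 0).length ≤ 3 * (n / (e * (2 * t + 3))) + 6 := by
  have hcut : ∀ k, ∃ y, 1 ≤ k → k < σ ^ t → 
      (y < 2 * t + 3 ∧ (∀ o, o + 1 < y → letter σ t (k - 1) o = letter σ t k o) ∧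
      (∀ o, y ≤ o → o < 2 * t + 3 → letter σ t k o = letter σ t 0 o)) := by
    intro k
    by_cases h : 1 ≤ k ∧ k < σ ^ t
    · obtain ⟨y, hy⟩ := exists_cut σ t k hσ h.1 h.2
      exact ⟨y, fun _ _ => hy⟩
    · exact ⟨0, fun h1 h2 => absurd ⟨h1, h2⟩ h⟩
  choose Y hY using hcut
  set P := 2 * t + 3 with hPdef
  set L := e * P with hLdef
  have hLP : 2 * P ≤ L := Nat.mul_le_mul_right P he
  set m := n / L with hm
  let C : Finset ℕ := insert 1 (insert 3 (insert n (((Finset.range (m + 1)).image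
    (fun k => (k + 1) * L)) ∪ ((Finset.range (m + 1)).image (fun k => k * L + Y k)) ∪
      ((Finset.range (m + 1)).image (fun k => k * L + P)))))
  have hCcard : C.card ≤ 3 * m + 6 := by
    have a1 := Finset.card_image_le (s := Finset.range (m + 1)) (f := fun k => (k + 1) * L)
    have a2 := Finset.card_image_le (s := Finset.range (m + 1)) (f := fun k => k * L + Y k)
    have a3 := Finset.card_image_le (s := Finset.range (m + 1)) (f := fun k => k * L + P)
    have b1 := Finset.card_union_le ((Finset.range (m + 1)).image
      (fun k => (k + 1) * L)) ((Finset.range (m + 1)).image (fun k => k * L + Y k))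
    have b2 := Finset.card_union_le (((Finset.range (m + 1)).image
      (fun k => (k + 1) * L)) ∪ ((Finset.range (m + 1)).image (fun k => k * L + Y k)))
      ((Finset.range (m + 1)).image (fun k => k * L + P))
    refine (Finset.card_insert_le _ _).trans ?_
    have c1 := Finset.card_insert_le 3 (insert n (((Finset.range (m + 1)).image
    (fun k => (k + 1) * L)) ∪ ((Finset.range (m + 1)).image (fun k => k * L + Y k)) ∪
      ((Finset.range (m + 1)).image (fun k => k * L + P))))
    have c2 := Finset.card_insert_le n (((Finset.range (m + 1)).image
    (fun k => (k + 1) * L)) ∪ ((Finset.range (m + 1)).image (fun k => k * L + Y k)) ∪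
      ((Finset.range (m + 1)).image (fun k => k * L + P)))
    simp only [Finset.card_range] at a1 a2 a3
    omega
  have hC1 : 1 ∈ C := by simp [C]
  have hC3 : 3 ∈ C := by simp [C]
  have hCn : n ∈ C := by simp [C]
  have hCL : ∀ k ≤ m, (k + 1) * L ∈ C := fun k hk => by
    simp only [C, Finset.mem_insert, Finset.mem_union, Finset.mem_image, Finset.mem_range]
    exact Or.inr (Or.inr (Or.inr (Or.inl (Or.inl ⟨k, by omega, rfl⟩))))
  have hCY : ∀ k ≤ m, k * L + Y k ∈ C := fun k hk => by
    simp only [C, Finset.mem_insert, Finset.mem_union, Finset.mem_image, Finset.mem_range]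
    exact Or.inr (Or.inr (Or.inr (Or.inl (Or.inr ⟨k, by omega, rfl⟩))))
  have hCP : ∀ k ≤ m, k * L + P ∈ C := fun k hk => by
    simp only [C, Finset.mem_insert, Finset.mem_union, Finset.mem_image, Finset.mem_range]
    exact Or.inr (Or.inr (Or.inr (Or.inr ⟨k, by omega, rfl⟩)))
  have hlen : ((List.range n).map f).length = n := by simp
  -- main step
  have key : ∀ p < n, ∃ c ∈ C, p < c ∧ c ≤ p + phraseLen PermOv3 ((List.range n).map f) p := by
    intro p hp
    have hle := len_le PermOv3 ((List.range n).map f) p (by simpa using hp)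
    have hpos := len_pos PermOv3 ((List.range n).map f) p
    rw [hlen] at hle
    -- reaching `q` suffices
    have reach : ∀ q ∈ C, p < q → (∃ j < p, ∀ x, p + x + 1 < q → f (j + x) = f (p + x)) →
        ∃ c ∈ C, p < c ∧ c ≤ p + phraseLen PermOv3 ((List.range n).map f) p := by
      rintro q hq hpq ⟨j, hj, h⟩
      have h1 := ov_reach f n p (min q n) j (by omega) (by omega) hj
        (fun x hx => h x (by omega))
      rcases le_total q n with h2 | h2
      · exact ⟨q, hq, hpq, by omega⟩
      · exact ⟨n, hCn, hp, by omega⟩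
    rcases Nat.eq_zero_or_pos p with h0 | h0
    · subst h0; exact ⟨1, hC1, by omega, by omega⟩
    obtain ⟨k, r, hr, hpk⟩ : ∃ k r, r < L ∧ p = k * L + r :=
      ⟨p / L, p % L, Nat.mod_lt _ (by omega), by rw [mul_comm]; exact (Nat.div_add_mod p L).symm⟩
    have hkm : k ≤ m := by
      rw [hm, Nat.le_div_iff_mul_le (by omega)]; omega
    have hkt : k < σ ^ t := by omega
    have hsk : ∀ k o, o < L → seq σ t L (k * L + o) = letter σ t k (o % P) :=
      fun k o ho => seq_at σ t e k o ho
    by_cases hrP : P ≤ r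
    · -- periodic part
      refine reach ((k + 1) * L) (hCL k hkm) (by rw [hpk, add_mul]; omega) ⟨p - P, by omega, ?_⟩
      intro x hx
      rw [add_mul] at hx
      rw [hf, show p - P + x = k * L + (r - P + x) by omega,
        show p + x = k * L + (r + x) by omega, hsk _ _ (by omega), hsk _ _ (by omega)]
      congr 1
      rw [show r + x = r - P + x + P by omega, Nat.add_mod_right]
    push Not at hrP
    rcases Nat.eq_zero_or_pos k with hk0 | hk0
    · subst hk0
      have hpr : p = r := by omega
      subst hpr
      have hs0 : ∀ o < P, seq σ t L o = letter σ t 0 o := by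
        intro o ho
        have := hsk 0 o (by omega)
        rwa [zero_mul, zero_add, Nat.mod_eq_of_lt ho] at this
      by_cases h3 : p < 3
      · refine reach 3 hC3 h3 ⟨0, h0, ?_⟩
        intro x hx
        have hx0 : x = 0 := by omega
        have hp1 : p = 1 := by omega
        subst hx0; subst hp1
        rw [hf, hs0 _ (by omega), hs0 _ (by omega)]
        simp [letter]
      · refine reach (0 * L + P) (hCP 0 hkm) (by omega) ⟨p - 2, by omega, ?_⟩
        intro x hx
        rw [hf, hs0 _ (by omega), hs0 _ (by omega)]
        unfold letter
        simp only [Nat.zero_div, Nat.zero_mod]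
        split_ifs <;> omega
    · obtain ⟨y1, y2, y3⟩ := hY k hk0 hkt
      have hkL : L ≤ k * L := Nat.le_mul_of_pos_left L hk0
      by_cases hry : r < Y k
      · refine reach (k * L + Y k) (hCY k hkm) (by omega) ⟨p - P, by omega, ?_⟩
        intro x hx
        obtain ⟨k', rfl⟩ : ∃ k', k = k' + 1 := ⟨k - 1, by omega⟩
        have he1 : (k' + 1) * L = k' * L + L := by ring
        rw [hf, show p - P + x = k' * L + (L - P + (r + x)) by omega,
          show p + x = (k' + 1) * L + (r + x) by omega, hsk _ _ (by omega), hsk _ _ (by omega)]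
        have hLP' : (L - P + (r + x)) % P = (r + x) % P := by
          have : L - P = P * (e - 1) := by
            rw [hLdef, Nat.mul_sub, mul_comm, mul_one]
          rw [this, add_comm, Nat.add_mul_mod_self_left]
        rw [hLP', Nat.mod_eq_of_lt (by omega)]
        exact y2 _ (by omega)
      · refine reach (k * L + P) (hCP k hkm) (by omega) ⟨r, by omega, ?_⟩
        intro x hx
        have := hsk 0 (r + x) (by omega)
        rw [zero_mul, zero_add] at this
        rw [hf, this, show p + x = k * L + (r + x) by omega, hsk _ _ (by omega),
          Nat.mod_eq_of_lt (by omega)]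
        exact (y3 _ (by omega) (by omega)).symm
  have := count_le PermOv3 ((List.range n).map f) (fun p => (C.filter (· ≤ p)).card) (by
    intro p hp
    rw [hlen] at hp
    obtain ⟨c, hc, h1, h2⟩ := key p hp
    have hss : C.filter (· ≤ p) ⊂ C.filter (· ≤ p + phraseLen PermOv3 ((List.range n).map f) p) := by
      rw [Finset.ssubset_iff_of_subset]
      · exact ⟨c, by simp [hc, h2], by simp [h1]⟩
      · intro u hu
        simp only [Finset.mem_filter] at hu ⊢
        exact ⟨hu.1, by omega⟩
    exact Finset.card_lt_card hss) n 0 (by simp)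
  have h2 := Finset.card_filter_le C (· ≤ n)
  simp only [hlen] at this
  omega

lemma ov_lower (f : ℕ → α) (σ t e n : ℕ) (ht : 1 ≤ t) (he : 2 ≤ e)
    (hf : ∀ a b, f a = f b ↔ seq σ t (e * (2 * t + 3)) a = seq σ t (e * (2 * t + 3)) b)
    (hn : n / (e * (2 * t + 3)) < σ ^ t) :
    n / (e * (2 * t + 3)) ≤ (phrasesFrom PermOv3 ((List.range n).map f) 0).length := by
  have hW := fun a j => word_new σ t e a j ht (by omega)
  set P := 2 * t + 3 with hPdef
  set L := e * P with hLdef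
  have hLP : 2 * P ≤ L := Nat.mul_le_mul_right P he
  have hlen : ((List.range n).map f).length = n := by simp
  have hstep : ∀ p < n, (p + phraseLen PermOv3 ((List.range n).map f) p + (L - P - 1)) / L
      ≤ (p + (L - P - 1)) / L + 1 := by
    intro p hp
    have hle := len_le PermOv3 ((List.range n).map f) p (by simpa using hp)
    rw [hlen] at hle
    by_contra hcon
    push Not at hcon
    set l := phraseLen PermOv3 ((List.range n).map f) p with hl
    obtain ⟨k, hk⟩ : ∃ k, (p + l + (L - P - 1)) / L = k + 1 :=
      ⟨(p + l + (L - P - 1)) / L - 1,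
        (fun u v (h : u + 1 < v) => (by omega : v = v - 1 + 1)) _ _ hcon⟩
    have h1 : (k + 1) * L ≤ p + l + (L - P - 1) := by
      rw [← Nat.le_div_iff_mul_le (by omega)]; omega
    have h2 : p + (L - P - 1) < k * L := by
      rw [← Nat.div_lt_iff_lt_mul (by omega)]; omega
    rw [add_mul, one_mul] at h1
    obtain ⟨j, hj, hjx⟩ := ov_spec f n p hp (by omega)
    have hkL : k * L / L = k := Nat.mul_div_cancel _ (by omega)
    have h3 := hW (k * L) (j + (k * L - p)) (by rw [hLdef, ← mul_assoc, Nat.mul_mod_left])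
      (by
        rw [hkL]
        refine lt_of_le_of_lt ?_ hn
        rw [Nat.le_div_iff_mul_le (by omega)]; omega)
      (by
        intro x hx
        have := hjx (k * L - p + x) (by omega)
        rw [hf] at this
        rw [add_assoc, this]
        congr 1
        omega)
    rw [hkL] at h3
    omega
  have := le_count PermOv3 ((List.range n).map f)
    (fun p => (((p + (L - P - 1)) / L : ℕ) : ℝ)) 1 (by
      intro p hp
      rw [hlen] at hp
      exact_mod_cast hstep p hp) n 0 (by simp)
  simp only [hlen, one_mul, zero_add] at this
  rw [Nat.div_eq_of_lt (by omega : L - P - 1 < L)] at this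
  have h3 : (n + (L - P - 1)) / L ≤ (phrasesFrom PermOv3 ((List.range n).map f) 0).length := by
    have h4 : (((n + (L - P - 1)) / L : ℕ) : ℝ) ≤
      ((phrasesFrom PermOv3 ((List.range n).map f) 0).length : ℝ) := by simpa using this
    exact_mod_cast h4
  exact (Nat.div_le_div_right (by omega)).trans h3

lemma nov_lower (f : ℕ → α) (σ t e n : ℕ) (ht : 1 ≤ t) (he : 2 ≤ e)
    (hf : ∀ a b, f a = f b ↔ seq σ t (e * (2 * t + 3)) a = seq σ t (e * (2 * t + 3)) b)
    (hn : n / (e * (2 * t + 3)) < σ ^ t) :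
    ((n / (e * (2 * t + 3)) : ℕ) : ℝ) * Real.logb 2
      ((((e * (2 * t + 3) : ℕ) : ℝ) + ((3 * (2 * t + 3) : ℕ) : ℝ)) / ((3 * (2 * t + 3) : ℕ) : ℝ))
      ≤ 2 * ((phrasesFrom PermNov3 ((List.range n).map f) 0).length : ℝ) := by
  have hW := fun a j => word_new σ t e a j ht (by omega)
  set P := 2 * t + 3 with hPdef
  set L := e * P with hLdef
  have hLP : 2 * P ≤ L := Nat.mul_le_mul_right P he
  have hlen : ((List.range n).map f).length = n := by simp
  set A := 3 * P with hA
  have hA0 : (0 : ℝ) < A := by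
    have : 0 < A := by omega
    exact_mod_cast this
  -- doubling
  have hdbl : ∀ p < n, min (phraseLen PermNov3 ((List.range n).map f) p) (L - p % L)
      ≤ p % L + A := by
    intro p hp
    by_contra hcon
    push Not at hcon
    have hle := len_le PermNov3 ((List.range n).map f) p (by simpa using hp)
    rw [hlen] at hle
    obtain ⟨j, hj, hjx⟩ := nov_spec f n p hp (by omega)
    set l := phraseLen PermNov3 ((List.range n).map f) p with hl
    have hpd : L * (p / L) + p % L = p := Nat.div_add_mod p L
    have hd := Nat.mod_lt p (by omega : 0 < L)
    obtain ⟨o, ho, hop⟩ : ∃ o < P, (p + o) % P = 0 := by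
      rcases Nat.eq_zero_or_pos (p % P) with h0 | h0
      · exact ⟨0, by omega, by simpa using h0⟩
      · refine ⟨P - p % P, by omega, ?_⟩
        have h5 : P * (p / P) + p % P = p := Nat.div_add_mod p P
        have h6 := Nat.mod_lt p (by omega : 0 < P)
        have : p + (P - p % P) = P * (p / P + 1) := by rw [mul_add]; omega
        rw [this, Nat.mul_mod_right]
    have hblk : (p + o) / L = p / L := by
      have : p + o = L * (p / L) + (p % L + o) := by omega
      rw [this, Nat.mul_add_div (by omega),
        Nat.div_eq_of_lt (by omega : p % L + o < L), add_zero]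
    have h3 := hW (p + o) (j + o) hop (by
        rw [hblk]
        exact lt_of_le_of_lt (Nat.div_le_div_right hp.le) hn)
      (by
        intro x hx
        have := hjx (o + x) (by omega)
        rw [hf] at this
        rw [add_assoc, this, add_assoc])
    rw [hblk, mul_comm] at h3
    omega
  -- a phrase ends soon after the beginning of a block
  have hend : ∀ p < n, ∀ k, p < k * L →
      p + phraseLen PermNov3 ((List.range n).map f) p ≤ k * L + P := by
    intro p hp k hk
    by_contra hcon
    push Not at hcon
    have hle := len_le PermNov3 ((List.range n).map f) p (by simpa using hp)
    rw [hlen] at hle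
    obtain ⟨j, hj, hjx⟩ := nov_spec f n p hp (by omega)
    set l := phraseLen PermNov3 ((List.range n).map f) p with hl
    have hkL : k * L / L = k := Nat.mul_div_cancel _ (by omega)
    have h3 := hW (k * L) (j + (k * L - p)) (by rw [hLdef, ← mul_assoc, Nat.mul_mod_left])
      (by
        rw [hkL]
        refine lt_of_le_of_lt ?_ hn
        rw [Nat.le_div_iff_mul_le (by omega)]; omega)
      (by
        intro x hx
        have := hjx (k * L - p + x) (by omega)
        rw [hf] at this
        rw [add_assoc, this]
        congr 1
        omega)
    rw [hkL] at h3
    omega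
  have hlog2 : ∀ a b : ℕ, a + A ≤ 2 * (b + A) →
      Real.logb 2 (((a : ℝ) + A) / A) ≤ Real.logb 2 (((b : ℝ) + A) / A) + 1 := by
    intro a b hab
    have hab' : (a : ℝ) + A ≤ 2 * (b + A) := by exact_mod_cast hab
    have hb : 0 < ((b : ℝ) + A) / A := by positivity
    have ha : 0 < ((a : ℝ) + A) / A := by positivity
    have h1 : Real.logb 2 (((a : ℝ) + A) / A) ≤ Real.logb 2 (2 * (((b : ℝ) + A) / A)) := by
      apply Real.logb_le_logb_of_le (by norm_num) ha
      rw [← mul_div_assoc]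
      gcongr
    rw [Real.logb_mul (by norm_num) hb.ne', Real.logb_self_eq_one (by norm_num)] at h1
    linarith
  set T := Real.logb 2 (((L : ℝ) + A) / A) with hT
  let Φ : ℕ → ℝ := fun p => ((p / L : ℕ) : ℝ) * T + Real.logb 2 ((((p % L : ℕ) : ℝ) + A) / A)
  have hmain := le_count PermNov3 ((List.range n).map f) Φ 2 (by
    intro p hp
    rw [hlen] at hp
    have h1 := hdbl p hp
    have h2 := hend p hp (p / L + 1) (by
      have hpd : L * (p / L) + p % L = p := Nat.div_add_mod p L
      have hd := Nat.mod_lt p (by omega : 0 < L)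
      rw [add_mul, mul_comm]; omega)
    set l := phraseLen PermNov3 ((List.range n).map f) p with hl
    have hpd : L * (p / L) + p % L = p := Nat.div_add_mod p L
    have hd := Nat.mod_lt p (by omega : 0 < L)
    simp only [Φ]
    generalize p / L = k at *
    generalize p % L = d at *
    rw [add_mul, mul_comm, one_mul] at h2
    by_cases hc : d + l < L
    · have e1 : (p + l) / L = k := by
        rw [show p + l = L * k + (d + l) by omega, Nat.mul_add_div (by omega),
          Nat.div_eq_of_lt hc, add_zero]
      have e2 : (p + l) % L = d + l := by
        rw [show p + l = L * k + (d + l) by omega, Nat.mul_add_mod, Nat.mod_eq_of_lt hc]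
      rw [e1, e2]
      have := hlog2 (d + l) d (by omega)
      linarith
    · have e1 : (p + l) / L = k + 1 := by
        rw [show p + l = L * (k + 1) + (d + l - L) by rw [mul_add]; omega,
          Nat.mul_add_div (by omega), Nat.div_eq_of_lt (by omega), add_zero]
      have e2 : (p + l) % L = d + l - L := by
        rw [show p + l = L * (k + 1) + (d + l - L) by rw [mul_add]; omega,
          Nat.mul_add_mod, Nat.mod_eq_of_lt (by omega)]
      rw [e1, e2]
      have g1 := hlog2 (d + l - L) 0 (by omega)
      have g2 := hlog2 L d (by omega)
      rw [← hT] at g2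
      rw [Nat.cast_zero, zero_add, div_self hA0.ne', Real.logb_one] at g1
      push_cast
      linarith) n 0 (by simp)
  rw [hlen] at hmain
  simp only [Φ, Nat.zero_div, Nat.zero_mod, Nat.cast_zero, zero_mul, zero_add, div_self hA0.ne',
    Real.logb_one] at hmain
  have hnn : 0 ≤ Real.logb 2 ((((n % L : ℕ) : ℝ) + A) / A) := by
    apply Real.logb_nonneg (by norm_num)
    rw [le_div_iff₀ hA0]
    have : (0 : ℝ) ≤ ((n % L : ℕ) : ℝ) := by positivity
    linarith
  linarith

end LZAux

set_option maxHeartbeats 1000000 in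
/-- There are constants `c₁, c₂, c₃ > 0` such that for all integers `n > 1`,
`2 ≤ σ ≤ n` and `σ ≤ z ≤ n / log_σ n`, there is a string `s` of length `n` over an alphabet
of size `σ` with `c₁·z ≤ Zov₃ ≤ c₂·z` and `Znon₃ ≥ c₃ · z · log₂(n / (z · log_σ z))`. -/
theorem exists_string_zNov3_large :
    ∃ c₁ c₂ c₃ : ℝ, 0 < c₁ ∧ 0 < c₂ ∧ 0 < c₃ ∧
      ∀ n σ z : ℕ, 1 < n → 2 ≤ σ → σ ≤ n → σ ≤ z →
        (z : ℝ) ≤ (n : ℝ) / Real.logb (σ : ℝ) (n : ℝ) →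
        ∃ s : List (Fin σ), s.length = n ∧
          c₁ * (z : ℝ) ≤ (zOv3 s : ℝ) ∧ (zOv3 s : ℝ) ≤ c₂ * (z : ℝ) ∧
          c₃ * (z : ℝ) * Real.logb 2 ((n : ℝ) / ((z : ℝ) * Real.logb (σ : ℝ) (z : ℝ)))
            ≤ (zNov3 s : ℝ) := by
  refine ⟨1 / 30, 6, 1 / 660, by norm_num, by norm_num, by norm_num, ?_⟩
  intro n σ z hn hσ hσn hσz hz
  have hσ1 : (1 : ℝ) < σ := by exact_mod_cast (by omega : 1 < σ)
  have hn0 : (0 : ℝ) < n := by exact_mod_cast (by omega : 0 < n)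
  have hz0 : (0 : ℝ) < z := by exact_mod_cast (by omega : 0 < z)
  have hlogn : 1 ≤ Real.logb σ n := by
    rw [Real.le_logb_iff_rpow_le hσ1 hn0, Real.rpow_one]; exact_mod_cast hσn
  have hlogz : 1 ≤ Real.logb σ z := by
    rw [Real.le_logb_iff_rpow_le hσ1 hz0, Real.rpow_one]; exact_mod_cast hσz
  rw [le_div_iff₀ (by linarith)] at hz
  have hzn : (z : ℝ) ≤ n := by nlinarith
  have hlzn : Real.logb σ z ≤ Real.logb σ n := Real.logb_le_logb_of_le hσ1 hz0 hzn
  set lz := Real.logb σ z with hlz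
  have hzlz : z * lz ≤ n := by nlinarith
  obtain ⟨t, ht⟩ : ∃ t, t = Nat.log σ z + 1 := ⟨_, rfl⟩
  have hzt : z < σ ^ t := by rw [ht]; exact Nat.lt_pow_succ_log_self (by omega) z
  obtain ⟨P, hP⟩ : ∃ P, P = 2 * t + 3 := ⟨_, rfl⟩
  have hPlz : (P : ℝ) ≤ 7 * lz := by
    have h1 : ((Nat.log σ z : ℕ) : ℝ) ≤ lz := Real.natLog_le_logb z σ
    rw [hP, ht]; push_cast; linarith
  have hPpos : 0 < P := by omega
  have hzP : z * P ≤ 7 * n := by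
    have : (z : ℝ) * P ≤ 7 * n := by nlinarith
    exact_mod_cast this
  have hzPpos : 0 < z * P := Nat.mul_pos (by omega) hPpos
  obtain ⟨e, he⟩ : ∃ e, e = n / (z * P) + 2 := ⟨_, rfl⟩
  have he2 : 2 ≤ e := by rw [he]; exact Nat.le_add_left _ _
  obtain ⟨L, hL⟩ : ∃ L, L = e * P := ⟨_, rfl⟩
  have hzL : z * L = z * P * (n / (z * P)) + 2 * (z * P) := by rw [hL, he]; ring
  have hdm := Nat.div_add_mod n (z * P)
  have hmod := Nat.mod_lt n hzPpos
  have hnzL : n ≤ z * L := by omega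
  have hzL15 : z * L ≤ 15 * n := by omega
  have hL2P : 2 * P ≤ L := by rw [hL]; exact Nat.mul_le_mul_right P he2
  have hLpos : 0 < L := by omega
  obtain ⟨m, hm⟩ : ∃ m, m = n / L := ⟨_, rfl⟩
  have hmz : m ≤ z := by
    rw [hm]; exact Nat.div_le_of_le_mul (by rw [mul_comm]; exact hnzL)
  have hm15 : z < 15 * (m + 1) := by
    have h1 : n < (m + 1) * L := by
      rw [← Nat.div_lt_iff_lt_mul hLpos]; omega
    have h2 : z * L < 15 * (m + 1) * L := by nlinarith
    exact Nat.lt_of_mul_lt_mul_right h2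
  let f : ℕ → Fin σ := fun p => ⟨LZAux.seq σ t L p, LZAux.letter_lt _ _ _ _ hσ⟩
  have hf : ∀ a b, f a = f b ↔ LZAux.seq σ t (e * (2 * t + 3)) a
      = LZAux.seq σ t (e * (2 * t + 3)) b := by
    intro a b
    simp [f, hL, hP]
  have hnt : n / (e * (2 * t + 3)) < σ ^ t := by
    rw [← hP, ← hL, ← hm]; omega
  have hA := LZAux.ov_upper f σ t e n hσ (by omega) he2 hf hnt
  have hB := LZAux.ov_lower f σ t e n (by omega) he2 hf hnt
  have hC := LZAux.nov_lower f σ t e n (by omega) he2 hf hnt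
  rw [← hP, ← hL, ← hm] at hA hB hC
  have hB1 := LZAux.count_pos PermOv3 ((List.range n).map f) (by simp; omega)
  have hC1 := LZAux.count_pos PermNov3 ((List.range n).map f) (by simp; omega)
  refine ⟨(List.range n).map f, by simp, ?_, ?_, ?_⟩
  · have h1 : z ≤ 30 * zOv3 ((List.range n).map f) := by
      change z ≤ 30 * (phrasesFrom PermOv3 ((List.range n).map f) 0).length
      omega
    have h2 : (z : ℝ) ≤ 30 * zOv3 ((List.range n).map f) := by exact_mod_cast h1
    linarith
  · have h1 : zOv3 ((List.range n).map f) ≤ 6 * z := by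
      change (phrasesFrom PermOv3 ((List.range n).map f) 0).length ≤ 6 * z
      omega
    exact_mod_cast h1
  · change _ ≤ (((phrasesFrom PermNov3 ((List.range n).map f) 0).length : ℕ) : ℝ)
    have hC1' : (1 : ℝ) ≤ (((phrasesFrom PermNov3 ((List.range n).map f) 0).length : ℕ) : ℝ) := by
      exact_mod_cast hC1
    generalize (((phrasesFrom PermNov3 ((List.range n).map f) 0).length : ℕ) : ℝ) = N at *
    have hlz0 : 0 < lz := by linarith
    have hR0 : 0 < (n : ℝ) / (z * lz) := by positivity
    obtain ⟨R, hR⟩ : ∃ R, R = (n : ℝ) / (z * lz) := ⟨_, rfl⟩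
    rw [← hR] at hR0 ⊢
    suffices hs : z * Real.logb 2 R ≤ 660 * N by linarith
    rcases le_or_gt (Real.logb 2 R) 0 with hneg | hpos
    · have : z * Real.logb 2 R ≤ 0 := mul_nonpos_of_nonneg_of_nonpos hz0.le hneg
      linarith
    rcases Nat.eq_zero_or_pos m with hm0 | hm0
    · -- degenerate case
      have hnL : n < L := by
        rw [hm] at hm0
        rcases Nat.div_eq_zero_iff.1 hm0 with h | h <;> omega
      have h4P : n < 4 * P := by
        have h1 : 2 * (P * (n / (z * P))) ≤ n := by
          have h2 : 2 * (P * (n / (z * P))) ≤ z * (P * (n / (z * P))) :=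
            Nat.mul_le_mul_right _ (by omega)
          rw [← mul_assoc z] at h2
          omega
        have h3 : L = P * (n / (z * P)) + 2 * P := by rw [hL, he]; ring
        omega
      have h4P' : (n : ℝ) ≤ 4 * P := by exact_mod_cast h4P.le
      have hz15 : (z : ℝ) ≤ 15 := by exact_mod_cast (by omega : z ≤ 15)
      have hz2 : (2 : ℝ) ≤ z := by exact_mod_cast (by omega : 2 ≤ z)
      have hR16 : R ≤ (2 : ℝ) ^ (4 : ℝ) := by
        rw [hR, div_le_iff₀ (by positivity)]
        norm_num
        nlinarith
      have hl4 : Real.logb 2 R ≤ 4 := by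
        rw [Real.logb_le_iff_le_rpow (by norm_num) hR0]; exact hR16
      nlinarith
    · have hP0 : (0 : ℝ) < P := by exact_mod_cast hPpos
      have hL2P' : (2 : ℝ) * P ≤ L := by exact_mod_cast hL2P
      have hnzL' : (n : ℝ) ≤ z * L := by exact_mod_cast hnzL
      have hm30 : (z : ℝ) ≤ 30 * m := by exact_mod_cast (by omega : z ≤ 30 * m)
      push_cast at hC
      set T := Real.logb 2 (((L : ℝ) + 3 * P) / (3 * P)) with hT
      have hX0 : 0 < ((L : ℝ) + 3 * P) / (3 * P) := by positivity
      have hT2 : 1 / 2 ≤ T := by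
        have h1 : (1 : ℝ) ≤ 2 * T := by
          have h2 : 2 * T = Real.logb 2 ((((L : ℝ) + 3 * P) / (3 * P)) ^ 2) := by
            rw [Real.logb_pow]; push_cast; rfl
          rw [h2, Real.le_logb_iff_rpow_le (by norm_num) (by positivity), Real.rpow_one]
          have h3 : (5 / 3 : ℝ) ≤ ((L : ℝ) + 3 * P) / (3 * P) := by
            rw [le_div_iff₀ (by positivity)]; linarith
          nlinarith
        linarith
      have hT5 : Real.logb 2 R ≤ T + 5 := by
        have h1 : R ≤ (((L : ℝ) + 3 * P) / (3 * P)) * 2 ^ (5 : ℕ) := by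
          have h2 : R ≤ L / lz := by
            rw [hR, div_le_div_iff₀ (by positivity) hlz0]
            have h5 := mul_le_mul_of_nonneg_right hnzL' hlz0.le
            linarith
          have h3 : (L : ℝ) / lz ≤ (L / (3 * P)) * 21 := by
            rw [div_mul_eq_mul_div, div_le_div_iff₀ hlz0 (by positivity)]
            have h5 : (0 : ℝ) ≤ L := by positivity
            have h6 := mul_le_mul_of_nonneg_left hPlz h5
            linarith
          have h4 : (L : ℝ) / (3 * P) ≤ (L + 3 * P) / (3 * P) := by
            gcongr; linarith
          norm_num
          linarith
        have h2 := Real.logb_le_logb_of_le (by norm_num : (1 : ℝ) < 2) hR0 h1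
        rw [Real.logb_mul hX0.ne' (by norm_num), Real.logb_pow,
          Real.logb_self_eq_one (by norm_num)] at h2
        push_cast at h2
        linarith
      have hm0' : (0 : ℝ) ≤ m := by positivity
      have h1 : z * Real.logb 2 R ≤ 30 * m * (11 * T) := by
        apply mul_le_mul hm30 (by linarith) hpos.le (by positivity)
      linarith
end
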